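/- arXiv:1904.09333 — 3 statements merged into one kernel-verified Lean document; each statement's English description precedes it below -/
import Mathlib

section
/- Let k ∈ {3, 4}, let g ≥ k be an integer, and let E be any finite family of g − k complex numbers. Define the g×g complex matrix Ŝ by Ŝ_{i,j} = (−1)^{i+j} ( 2 s_{i−k+1}(E) s_{j−k+1}(E) − s_{i−k+2}(E) s_{j−k}(E) − s_{i−k}(E) s_{j−k+2}(E) ) for 1 ≤ i, j ≤ g. Then the rank of Ŝ equals 3; consequently, for every invertible complex g×g matrix ω, the matrix ωᵀ Ŝ ω has rank 3. -/
open Matrix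

/-- Elementary symmetric polynomial of integer degree `n` in the members of the finite
family (multiset) `E`, with the conventions `s_0 = 1` and `s_n = 0` for `n < 0` or
`n > |E|` (the latter being automatic for `Multiset.esymm`). -/
noncomputable def esymZ (E : Multiset ℂ) (n : ℤ) : ℂ :=
  if 0 ≤ n then E.esymm n.toNat else 0

/-- The `g × g` matrix of second derivative theta constants (up to a nonzero factor):
`Ŝ_{i,j} = (−1)^{i+j} (2 s_{i−k+1}(E) s_{j−k+1}(E) − s_{i−k+2}(E) s_{j−k}(E)
− s_{i−k}(E) s_{j−k+2}(E))` for `1 ≤ i, j ≤ g` (here `i, j : Fin g` are 0-indexed,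
so the paper's index is `i+1`). -/
noncomputable def ShatMatrix (g : ℕ) (k : ℕ) (E : Multiset ℂ) :
    Matrix (Fin g) (Fin g) ℂ :=
  Matrix.of fun i j =>
    (-1 : ℂ) ^ ((i : ℕ) + (j : ℕ)) *
      (2 * esymZ E ((i : ℤ) + 2 - k) * esymZ E ((j : ℤ) + 2 - k) -
        esymZ E ((i : ℤ) + 3 - k) * esymZ E ((j : ℤ) + 1 - k) -
        esymZ E ((i : ℤ) + 1 - k) * esymZ E ((j : ℤ) + 3 - k))

theorem esymZ_of_neg (E : Multiset ℂ) {n : ℤ} (hn : n < 0) : esymZ E n = 0 :=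
  if_neg (not_le.mpr hn)

theorem esymZ_zero (E : Multiset ℂ) : esymZ E 0 = 1 := by
  simp [esymZ, Multiset.esymm]

/-- `ShatMatrix g k E` factors through a three-dimensional space. -/
theorem rank_ShatMatrix_le (g k : ℕ) (E : Multiset ℂ) : (ShatMatrix g k E).rank ≤ 3 := by
  let A : Matrix (Fin g) (Fin 3) ℂ :=
    Matrix.of fun i t => (-1) ^ (i : ℕ) * esymZ E ((i : ℤ) + 1 + (t : ℕ) - k)
  let C : Matrix (Fin 3) (Fin 3) ℂ := !![0, 0, -1; 0, 2, 0; -1, 0, 0]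
  have h : ShatMatrix g k E = A * (C * Aᵀ) := by
    ext i j
    have h2 (m : ℤ) : m + 1 + 1 = m + 2 := by ring
    have h3 (m : ℤ) : m + 1 + 2 = m + 3 := by ring
    simp [ShatMatrix, A, C, Matrix.mul_apply, Matrix.vecMul, dotProduct, Fin.sum_univ_three, h2, h3]
    ring
  rw [h]
  exact (Matrix.rank_mul_le_left _ _).trans (by simpa using A.rank_le_card_width)

/-- The rows and columns `k - 3, k - 2, k - 1` of `ShatMatrix g k E` give an
antitriangular minor equal to `-2`. -/
theorem det_submatrix_ShatMatrix {g k : ℕ} (hk : 3 ≤ k) (E : Multiset ℂ) (f : Fin 3 → Fin g)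
    (hf : ∀ t, (f t : ℕ) = k - 3 + t) :
    ((ShatMatrix g k E).submatrix f f).det = -2 := by
  obtain ⟨m, rfl⟩ := Nat.exists_eq_add_of_le' hk
  have e (t : Fin 3) (c : ℤ) :
      ((f t : ℕ) : ℤ) + c - ((m + 3 : ℕ) : ℤ) = (t : ℕ) + c - 3 := by
    rw [hf]; push_cast; omega
  have hs (a b : Fin 3) : (-1 : ℂ) ^ ((f a : ℕ) + (f b : ℕ)) = (-1) ^ ((a : ℕ) + (b : ℕ)) := by
    rw [hf, hf, show m + 3 - 3 + (a : ℕ) + (m + 3 - 3 + b) = 2 * m + (a + b) by omega, pow_add,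
      pow_mul]
    simp
  have n1 : esymZ E (-1) = 0 := esymZ_of_neg E (by norm_num)
  have n2 : esymZ E (-2) = 0 := esymZ_of_neg E (by norm_num)
  rw [Matrix.det_fin_three]
  simp only [Matrix.submatrix_apply, ShatMatrix, Matrix.of_apply, e, hs]
  norm_num [n1, n2, esymZ_zero]

theorem three_le_rank_ShatMatrix {g k : ℕ} (hk : 3 ≤ k) (hg : k ≤ g) (E : Multiset ℂ) :
    3 ≤ (ShatMatrix g k E).rank := by
  let f : Fin 3 → Fin g := fun t => ⟨k - 3 + t, by omega⟩
  have hdet := det_submatrix_ShatMatrix hk E f fun _ => rfl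
  have hu : IsUnit ((ShatMatrix g k E).submatrix f f) := by
    rw [Matrix.isUnit_iff_isUnit_det, hdet]
    simp
  calc 3 = ((ShatMatrix g k E).submatrix f f).rank := by simp [Matrix.rank_of_isUnit _ hu]
    _ ≤ (ShatMatrix g k E).rank := Matrix.rank_submatrix_le _ _ _

/-- For `k ∈ {3,4}`, `g ≥ k`, and any family `E` of `g − k` complex
numbers, the matrix `Ŝ` has rank 3, and hence so does `ωᵀ Ŝ ω` for every invertible
`ω` (Theorem 4 of the paper: Hessians of multiplicity-2 theta constants have rank 3). -/
theorem rank_second_derivative_theta_constants (g k : ℕ)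
    (hk : k = 3 ∨ k = 4) (hg : k ≤ g)
    (E : Multiset ℂ) (hE : Multiset.card E = g - k) :
    (ShatMatrix g k E).rank = 3 ∧
      ∀ ω : Matrix (Fin g) (Fin g) ℂ, IsUnit ω.det →
        (ωᵀ * ShatMatrix g k E * ω).rank = 3 := by
  have h : (ShatMatrix g k E).rank = 3 :=
    le_antisymm (rank_ShatMatrix_le g k E) (three_le_rank_ShatMatrix (by omega) hg E)
  refine ⟨h, fun ω hω => ?_⟩
  rw [Matrix.rank_mul_eq_left_of_isUnit_det _ _ hω,
    Matrix.rank_mul_eq_right_of_isUnit_det _ _ (by rwa [Matrix.det_transpose]), h]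
end

section
/- Let k ∈ {3, 4}, let g ≥ 4 with g ≥ k, and let E be any finite family of g − k complex numbers. Define the g×g complex matrix Ŝ by Ŝ_{i,j} = (−1)^{i+j} ( 2 s_{i−k+1}(E) s_{j−k+1}(E) − s_{i−k+2}(E) s_{j−k}(E) − s_{i−k}(E) s_{j−k+2}(E) ) for 1 ≤ i, j ≤ g. Then for every complex g×g matrix ω (not necessarily invertible), det(ωᵀ Ŝ ω) = 0; in particular det Ŝ = 0. -/
open Matrix

/-- A product of matrices factoring through a strictly smaller index type is singular. -/
theorem Matrix.det_mul_eq_zero_of_card_lt {m n K : Type*} [Fintype m] [DecidableEq m] [Fintype n]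
    [Field K] (h : Fintype.card n < Fintype.card m) (A : Matrix m n K) (B : Matrix n m K) :
    (A * B).det = 0 := by
  by_contra hdet
  have hrank : (A * B).rank = Fintype.card m :=
    rank_of_isUnit _ ((isUnit_iff_isUnit_det _).2 (isUnit_iff_ne_zero.2 hdet))
  have hle : (A * B).rank ≤ Fintype.card n := (rank_mul_le_left A B).trans (rank_le_card_width A)
  omega

/-- The matrix `ShatMatrix g k E` has rank at most three. -/
theorem ShatMatrix_eq_mul (g k : ℕ) (E : Multiset ℂ) :
    ∃ (A : Matrix (Fin g) (Fin 3) ℂ) (B : Matrix (Fin 3) (Fin g) ℂ), ShatMatrix g k E = A * B := by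
  let s : ℤ → Fin g → ℂ := fun c i => (-1) ^ (i : ℕ) * esymZ E ((i : ℤ) + c - k)
  refine ⟨of fun i => ![2 * s 2 i, -s 3 i, -s 1 i], of ![s 2, s 1, s 3], ?_⟩
  ext i j
  simp only [ShatMatrix, s, mul_apply, of_apply, Fin.sum_univ_three, cons_val, pow_add]
  ring

/-- For `k ∈ {3,4}`, `g ≥ 4` with `g ≥ k`, and any family `E` of
`g − k` complex numbers, `det(ωᵀ Ŝ ω) = 0` for every complex `g×g` matrix `ω`;
in particular `det Ŝ = 0` (the determinant clause of Theorem 4 of the paper). -/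
theorem det_second_derivative_theta_constants (g k : ℕ)
    (hk : k = 3 ∨ k = 4) (hg4 : 4 ≤ g) (hg : k ≤ g)
    (E : Multiset ℂ) (hE : Multiset.card E = g - k) :
    (∀ ω : Matrix (Fin g) (Fin g) ℂ, (ωᵀ * ShatMatrix g k E * ω).det = 0) ∧
      (ShatMatrix g k E).det = 0 := by
  have hdet : (ShatMatrix g k E).det = 0 := by
    obtain ⟨A, B, hAB⟩ := ShatMatrix_eq_mul g k E
    rw [hAB]
    exact det_mul_eq_zero_of_card_lt (by simp only [Fintype.card_fin]; omega) A B
  exact ⟨fun ω => by simp [det_mul, hdet], hdet⟩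
end

section
/- Let k ∈ {5, 6}, let g ≥ k be an integer, and let E be a finite family of g − k complex numbers. Define the order-3 array Ŝ ∈ ℂ^{g×g×g} by Ŝ_{j₁,j₂,j₃} = (−1)^{j₁+j₂+j₃−3k} ( 6 s_{j₁−k+2}(E) s_{j₂−k+2}(E) s_{j₃−k+2}(E) − 2·{(3,2,1)} + 2·{(0,3,3)} + 2·{(1,1,4)} − {(0,2,4)} ), where {(d₁,d₂,d₃)} denotes the sum of s_{j₁−k+a}(E) s_{j₂−k+b}(E) s_{j₃−k+c}(E) over all distinct ordered rearrangements (a,b,c) of the multiset {d₁,d₂,d₃}. Define the vectors 𝐬_d ∈ ℂ^g (d = 0, 1, 2, 3, 4) by (𝐬_d)_j = (−1)^j s_{j−k+d}(E). Then for every fixed pair (j₂, j₃), the vector (Ŝ_{j₁,j₂,j₃})_{j₁=1}^{g} lies in the linear span of 𝐬₀, 𝐬₁, 𝐬₂, 𝐬₃, 𝐬₄; consequently the mode-1 flattening of Ŝ, viewed as a g × g² complex matrix, has rank at most 5. -/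
open Matrix

/-- The order-3 array `Ŝ ∈ ℂ^{g×g×g}` of Corollary 4.3 of the paper:
`Ŝ_{j₁,j₂,j₃} = (−1)^{j₁+j₂+j₃−3k} (6 s_{j₁−k+2}s_{j₂−k+2}s_{j₃−k+2} − 2·{(3,2,1)}
+ 2·{(0,3,3)} + 2·{(1,1,4)} − {(0,2,4)})`, where `{(d₁,d₂,d₃)}` is the sum of
`s_{j₁−k+a}s_{j₂−k+b}s_{j₃−k+c}` over all distinct ordered rearrangements `(a,b,c)`
of `{d₁,d₂,d₃}` (indices `jᵢ : Fin g` are 0-indexed, the paper's index is `jᵢ+1`). -/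
noncomputable def Shat3 (g : ℕ) (k : ℕ) (E : Multiset ℂ)
    (j₁ j₂ j₃ : Fin g) : ℂ :=
  let S : ℤ → ℤ → ℤ → ℂ := fun a b c =>
    esymZ E ((j₁ : ℤ) + 1 - k + a) * esymZ E ((j₂ : ℤ) + 1 - k + b) *
      esymZ E ((j₃ : ℤ) + 1 - k + c)
  (-1 : ℂ) ^ (((j₁ : ℤ) + 1) + ((j₂ : ℤ) + 1) + ((j₃ : ℤ) + 1) - 3 * (k : ℤ)) *
    (6 * S 2 2 2
      - 2 * (S 3 2 1 + S 3 1 2 + S 2 3 1 + S 2 1 3 + S 1 3 2 + S 1 2 3)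
      + 2 * (S 0 3 3 + S 3 0 3 + S 3 3 0)
      + 2 * (S 1 1 4 + S 1 4 1 + S 4 1 1)
      - (S 0 2 4 + S 0 4 2 + S 2 0 4 + S 2 4 0 + S 4 0 2 + S 4 2 0))

/-- The vector `𝐬_d ∈ ℂ^g` with entries `(𝐬_d)_j = (−1)^j s_{j−k+d}(E)` (paper index
`j = 1, …, g`, i.e. `j` is the 0-indexed coordinate plus one). -/
noncomputable def sVec (g : ℕ) (k : ℕ) (E : Multiset ℂ) (d : ℤ) : Fin g → ℂ :=
  fun j => (-1 : ℂ) ^ ((j : ℕ) + 1) * esymZ E ((j : ℤ) + 1 - k + d)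

/-- A mode-1 slice of `Shat3`, written out as a combination of the vectors `sVec`. -/
theorem Shat3_slice_eq (g k : ℕ) (E : Multiset ℂ) (j₂ j₃ : Fin g) :
    (fun j₁ => Shat3 g k E j₁ j₂ j₃) =
      let T : ℤ → ℂ := fun b => esymZ E ((j₂ : ℤ) + 1 - k + b)
      let U : ℤ → ℂ := fun c => esymZ E ((j₃ : ℤ) + 1 - k + c)
      (-1 : ℂ) ^ (((j₂ : ℤ) + 1) + ((j₃ : ℤ) + 1) - 3 * (k : ℤ)) •
        ((2 * (T 3 * U 3) - T 2 * U 4 - T 4 * U 2) • sVec g k E 0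
          + (2 * (T 1 * U 4 + T 4 * U 1) - 2 * (T 2 * U 3 + T 3 * U 2)) • sVec g k E 1
          + (6 * (T 2 * U 2) - 2 * (T 3 * U 1 + T 1 * U 3) - T 0 * U 4 - T 4 * U 0) •
              sVec g k E 2
          + (2 * (T 0 * U 3 + T 3 * U 0) - 2 * (T 2 * U 1 + T 1 * U 2)) • sVec g k E 3
          + (2 * (T 1 * U 1) - T 0 * U 2 - T 2 * U 0) • sVec g k E 4) := by
  funext j₁
  have hsign : (-1 : ℂ) ^ (((j₁ : ℤ) + 1) + ((j₂ : ℤ) + 1) + ((j₃ : ℤ) + 1) - 3 * (k : ℤ)) =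
      (-1 : ℂ) ^ ((j₁ : ℕ) + 1) *
        (-1 : ℂ) ^ (((j₂ : ℤ) + 1) + ((j₃ : ℤ) + 1) - 3 * (k : ℤ)) := by
    rw [← zpow_natCast, ← zpow_add₀ (by norm_num)]
    congr 1
    push_cast
    ring
  simp only [Shat3, hsign, sVec, Pi.smul_apply, Pi.add_apply, smul_eq_mul]
  ring

theorem Shat3_slice_mem_span (g k : ℕ) (E : Multiset ℂ) (j₂ j₃ : Fin g) :
    (fun j₁ => Shat3 g k E j₁ j₂ j₃) ∈
      Submodule.span ℂ ({sVec g k E 0, sVec g k E 1, sVec g k E 2,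
        sVec g k E 3, sVec g k E 4} : Set (Fin g → ℂ)) := by
  rw [Shat3_slice_eq]
  refine Submodule.smul_mem _ _ (add_mem (add_mem (add_mem (add_mem ?_ ?_) ?_) ?_) ?_) <;>
    exact Submodule.smul_mem _ _ (Submodule.subset_span (by simp))

/-- For `k ∈ {5,6}`, `g ≥ k` and a family `E` of `g − k` complex
numbers, every mode-1 slice of the order-3 tensor `Ŝ` lies in the span of the five
vectors `𝐬₀, …, 𝐬₄`; consequently the mode-1 flattening of `Ŝ`, viewed as a `g × g²`
matrix, has rank at most 5. -/
theorem Shat3_slices_in_span (g k : ℕ) (hk : k = 5 ∨ k = 6) (hg : k ≤ g)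
    (E : Multiset ℂ) (hE : Multiset.card E = g - k) :
    (∀ j₂ j₃ : Fin g,
        (fun j₁ => Shat3 g k E j₁ j₂ j₃) ∈
          Submodule.span ℂ ({sVec g k E 0, sVec g k E 1, sVec g k E 2,
            sVec g k E 3, sVec g k E 4} : Set (Fin g → ℂ))) ∧
      (Matrix.of fun (j₁ : Fin g) (p : Fin g × Fin g) =>
          Shat3 g k E j₁ p.1 p.2).rank ≤ 5 := by
  refine ⟨Shat3_slice_mem_span g k E, ?_⟩
  classical
  let B : Finset (Fin g → ℂ) :=
    {sVec g k E 0, sVec g k E 1, sVec g k E 2, sVec g k E 3, sVec g k E 4}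
  rw [Matrix.rank_eq_finrank_span_cols]
  calc Module.finrank ℂ (Submodule.span ℂ (Set.range _))
      ≤ Module.finrank ℂ (Submodule.span ℂ (B : Set (Fin g → ℂ))) := by
        refine Submodule.finrank_mono (Submodule.span_le.2 ?_)
        rintro _ ⟨p, rfl⟩
        simpa [B] using! Shat3_slice_mem_span g k E p.1 p.2
    _ ≤ B.card := finrank_span_finset_le_card B
    _ ≤ 5 := Finset.card_le_five
end
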